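/- Let D be a total dissipator on M_d(ℂ) and let H : ℝ → M_d(ℂ) be differentiable with each H(t) Hermitian. Suppose there exist K_0 > 0 and γ_0 > 0 such that for every fixed t_0 ≥ 0 the constant instantaneous Lindbladian x ↦ −i[H(t_0), x] + D(x) is exponentially contractive with constants K_0 and γ_0. If sup_{t ≥ 0} ‖H'(t)‖_∞ < (2γ_0²/3) · 1/(1 + (2/3)·ln K_0 + (1/3)·(ln K_0)²), where ‖·‖_∞ denotes the operator norm, then the driven Lindbladian L_t(x) = −i[H(t), x] + D(x) is exponentially contractive. -/

import Mathlib

open scoped ComplexOrder Kronecker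
open Matrix

namespace Paper

variable {n : Type*} [Fintype n] [DecidableEq n]

/-- Trace norm: sum of singular values. -/
noncomputable def traceNorm (A : Matrix n n ℂ) : ℝ :=
  ∑ i, Real.sqrt ((Matrix.posSemidef_conjTranspose_mul_self A).isHermitian.eigenvalues i)

/-- The dissipator associated with a single jump operator. -/
noncomputable def dissipator (L x : Matrix n n ℂ) : Matrix n n ℂ :=
  L * x * Lᴴ - ((1 : ℂ)/2) • (Lᴴ * L * x + x * (Lᴴ * L))

/-- Total dissipator of a family of jump operators. -/
noncomputable def totalDissipator {m : ℕ} (L : Fin m → Matrix n n ℂ) (x : Matrix n n ℂ) :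
    Matrix n n ℂ :=
  ∑ j, dissipator (L j) x

/-- The Hamiltonian commutator term `-i[H, x]`. -/
noncomputable def hamTerm (H x : Matrix n n ℂ) : Matrix n n ℂ :=
  (-Complex.I) • (H * x - x * H)

/-- A solution of the master equation `ρ' = L_t(ρ)` starting at time `s`
(differentiable entrywise). -/
def IsSolution (Lt : ℝ → Matrix n n ℂ → Matrix n n ℂ) (s : ℝ) (ρ : ℝ → Matrix n n ℂ) : Prop :=
  ∀ t, s ≤ t → ∀ i j, HasDerivAt (fun u => ρ u i j) ((Lt t (ρ t)) i j) t

/-- Density matrix: Hermitian, positive semidefinite, trace one. -/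
def IsDensity (ρ : Matrix n n ℂ) : Prop := ρ.PosSemidef ∧ ρ.trace = 1

/-- Exponential contractivity with constants `K, γ` of a time-dependent Lindbladian. -/
def ExpContractiveWith (Lt : ℝ → Matrix n n ℂ → Matrix n n ℂ) (K γ : ℝ) : Prop :=
  ∀ s t : ℝ, 0 ≤ s → s ≤ t → ∀ ρ σ : ℝ → Matrix n n ℂ,
    IsSolution Lt s ρ → IsSolution Lt s σ → IsDensity (ρ s) → IsDensity (σ s) →
    traceNorm (ρ t - σ t) ≤ K * Real.exp (-γ * (t - s)) * traceNorm (ρ s - σ s)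

/-- Exponential contractivity of a time-dependent Lindbladian. -/
def ExpContractive (Lt : ℝ → Matrix n n ℂ → Matrix n n ℂ) : Prop :=
  ∃ K γ : ℝ, 0 < K ∧ 0 < γ ∧ ExpContractiveWith Lt K γ

/-- Time-dependent Hamiltonian: Hermitian values and continuous entries. -/
def IsHamiltonianFamily (H : ℝ → Matrix n n ℂ) : Prop :=
  (∀ t, (H t).IsHermitian) ∧ ∀ i j, Continuous fun t => H t i j

/-- Driven Lindbladian `x ↦ -i[H(t), x] + D(x)`. -/
noncomputable def driven {m : ℕ} (H : ℝ → Matrix n n ℂ) (L : Fin m → Matrix n n ℂ)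
    (t : ℝ) (x : Matrix n n ℂ) : Matrix n n ℂ :=
  hamTerm (H t) x + totalDissipator L x

/-- Hamiltonian-independent contractivity of a dissipator. -/
def HamIndepContractive {m : ℕ} (L : Fin m → Matrix n n ℂ) : Prop :=
  ∀ H : ℝ → Matrix n n ℂ, IsHamiltonianFamily H → ExpContractive (driven H L)

/-- The operator norm (largest singular value). -/
noncomputable def opNorm (A : Matrix n n ℂ) : ℝ :=
  ‖LinearMap.toContinuousLinearMap (Matrix.toEuclideanLin A)‖

end Paper

namespace Paper

section helpers

set_option linter.unusedSectionVars false

open scoped Matrix.Norms.L2Operator InnerProductSpace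

variable {n : Type*} [Fintype n] [DecidableEq n]

lemma opNorm_eq (A : Matrix n n ℂ) : opNorm A = ‖A‖ := rfl

lemma trace_eq_sum_inner_basis (A : Matrix n n ℂ)
    (b : OrthonormalBasis n ℂ (EuclideanSpace ℂ n)) :
    A.trace = ∑ i, ⟪b i, toEuclideanCLM (n := n) (𝕜 := ℂ) A (b i)⟫_ℂ := by
  have h := LinearMap.trace_eq_sum_inner (toEuclideanLin A) b
  rw [toEuclideanLin_eq_toLin_orthonormal, Matrix.trace_toLin_eq] at h
  exact h

/-- trace duality, upper bound -/
lemma re_trace_mul_le (U A : Matrix n n ℂ) : (U * A).trace.re ≤ ‖U‖ * traceNorm A := by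
  set hA := (Matrix.posSemidef_conjTranspose_mul_self A).isHermitian with hAdef
  rw [trace_eq_sum_inner_basis (U * A) hA.eigenvectorBasis, Complex.re_sum, traceNorm,
    Finset.mul_sum]
  refine Finset.sum_le_sum fun i _ => ?_
  set v := hA.eigenvectorBasis i with hv
  have hvn : ‖v‖ = 1 := hA.eigenvectorBasis.norm_eq_one i
  have h1 : ‖toEuclideanCLM (n := n) (𝕜 := ℂ) A v‖ = √(hA.eigenvalues i) := by
    rw [eq_comm, Real.sqrt_eq_iff_eq_sq ((Matrix.posSemidef_conjTranspose_mul_self A).eigenvalues_nonneg i) (norm_nonneg _)]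
    have h2 : toEuclideanCLM (n := n) (𝕜 := ℂ) (Aᴴ * A) v = (hA.eigenvalues i : ℂ) • v := by
      ext k
      have := congrFun (hA.mulVec_eigenvectorBasis i) k
      simpa using this
    have h3 : ⟪v, toEuclideanCLM (n := n) (𝕜 := ℂ) (Aᴴ * A) v⟫_ℂ
        = (‖toEuclideanCLM (n := n) (𝕜 := ℂ) A v‖ : ℂ) ^ 2 := by
      rw [map_mul, ← Matrix.star_eq_conjTranspose, map_star, ContinuousLinearMap.star_eq_adjoint]
      rw [mul_apply_eq_comp, ContinuousLinearMap.adjoint_inner_right]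
      exact inner_self_eq_norm_sq_to_K _
    rw [h2, inner_smul_right, inner_self_eq_norm_sq_to_K, hvn] at h3
    simp at h3
    exact_mod_cast h3
  calc (⟪v, toEuclideanCLM (n := n) (𝕜 := ℂ) (U * A) v⟫_ℂ).re 
      ≤ ‖⟪v, toEuclideanCLM (n := n) (𝕜 := ℂ) (U * A) v⟫_ℂ‖ := Complex.re_le_norm _
    _ ≤ ‖v‖ * ‖toEuclideanCLM (n := n) (𝕜 := ℂ) (U * A) v‖ := norm_inner_le_norm _ _
    _ = ‖toEuclideanCLM (n := n) (𝕜 := ℂ) U (toEuclideanCLM (n := n) (𝕜 := ℂ) A v)‖ := by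
        rw [hvn, one_mul, map_mul, mul_apply_eq_comp]
    _ ≤ ‖U‖ * ‖toEuclideanCLM (n := n) (𝕜 := ℂ) A v‖ := by
        rw [← Matrix.l2_opNorm_toEuclideanCLM]
        exact ContinuousLinearMap.le_opNorm _ _
    _ = _ := by rw [h1]

/-- trace duality, attained -/
lemma exists_trace_eq (A : Matrix n n ℂ) :
    ∃ U : Matrix n n ℂ, ‖U‖ ≤ 1 ∧ (U * A).trace.re = traceNorm A := by
  have hP := Matrix.posSemidef_conjTranspose_mul_self A
  set hA := hP.isHermitian with hAdef
  set V : Matrix n n ℂ := (hA.eigenvectorUnitary : Matrix n n ℂ) with hV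
  set e := hA.eigenvalues with he
  have he0 : ∀ i, 0 ≤ e i := hP.eigenvalues_nonneg
  have hVV : Vᴴ * V = 1 := Unitary.coe_star_mul_self hA.eigenvectorUnitary
  have hVn : V ∈ unitary (Matrix n n ℂ) := hA.eigenvectorUnitary.2
  have hsp : Aᴴ * A = V * diagonal (fun i => (e i : ℂ)) * Vᴴ := by
    have := hA.spectral_theorem
    rw [Unitary.conjStarAlgAut_apply] at this
    exact this
  set D : Matrix n n ℂ := diagonal (fun i => (((√(e i))⁻¹ : ℝ) : ℂ)) with hD
  have hDe : D * diagonal (fun i => (e i : ℂ)) = diagonal (fun i => ((√(e i) : ℝ) : ℂ)) := by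
    rw [hD, diagonal_mul_diagonal]
    congr 1; ext i
    rw [← Complex.ofReal_mul]
    congr 1
    by_cases h : √(e i) = 0
    · simp [h]
    · field_simp
      exact (Real.sq_sqrt (he0 i)).symm
  refine ⟨V * D * Vᴴ * Aᴴ, ?_, ?_⟩
  · set U := V * D * Vᴴ * Aᴴ with hU
    have h1 : U * Uᴴ = V * diagonal (fun i => (((√(e i)) * (√(e i))⁻¹ : ℝ) : ℂ)) * Vᴴ := by
      have hDD : Dᴴ = D := by
        rw [hD, diagonal_conjTranspose]; congr 1; ext i; simp
      calc U * Uᴴ = V * D * Vᴴ * (Aᴴ * A) * (V * D * Vᴴ) := by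
            rw [hU]; simp only [conjTranspose_mul, conjTranspose_conjTranspose, hDD, Matrix.mul_assoc]
        _ = V * D * (Vᴴ * V) * diagonal (fun i => (e i : ℂ)) * (Vᴴ * V) * D * Vᴴ := by
            rw [hsp]; simp only [Matrix.mul_assoc]
        _ = V * ((D * diagonal (fun i => (e i : ℂ))) * D) * Vᴴ := by
            rw [hVV]; simp only [Matrix.mul_assoc, Matrix.one_mul]
        _ = _ := by
            rw [hDe, hD, diagonal_mul_diagonal]
            simp only [Complex.ofReal_mul]
    have h2 : ‖U‖ * ‖U‖ ≤ 1 := by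
      rw [← l2_opNorm_conjTranspose U, ← l2_opNorm_conjTranspose_mul_self, conjTranspose_conjTranspose, h1]
      rw [← star_eq_conjTranspose, CStarRing.norm_mul_mem_unitary _ (Unitary.star_mem hVn),
        CStarRing.norm_mem_unitary_mul _ hVn, l2_opNorm_diagonal]
      refine (pi_norm_le_iff_of_nonneg zero_le_one).2 fun i => ?_
      rw [Complex.norm_real]
      by_cases h : √(e i) = 0
      · simp [h]
      · rw [mul_inv_cancel₀ h]; simp
    nlinarith [norm_nonneg U]
  · have : V * D * Vᴴ * Aᴴ * A = V * diagonal (fun i => ((√(e i) : ℝ) : ℂ)) * Vᴴ := by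
      calc _ = V * D * Vᴴ * (Aᴴ * A) := by simp only [Matrix.mul_assoc]
        _ = V * D * (Vᴴ * V) * diagonal (fun i => (e i : ℂ)) * Vᴴ := by
          rw [hsp]; simp only [Matrix.mul_assoc]
        _ = V * (D * diagonal (fun i => (e i : ℂ))) * Vᴴ := by
          rw [hVV]; simp only [Matrix.mul_assoc, Matrix.one_mul]
        _ = _ := by rw [hDe]
    rw [this, Matrix.trace_mul_comm, ← Matrix.mul_assoc, hVV, Matrix.one_mul, trace_diagonal,
      Complex.re_sum]
    simp only [Complex.ofReal_re]
    rfl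

lemma traceNorm_nonneg (A : Matrix n n ℂ) : 0 ≤ traceNorm A :=
  Finset.sum_nonneg fun _ _ => Real.sqrt_nonneg _

lemma traceNorm_le_of {A : Matrix n n ℂ} {r : ℝ}
    (h : ∀ U : Matrix n n ℂ, ‖U‖ ≤ 1 → (U * A).trace.re ≤ r) : traceNorm A ≤ r := by
  obtain ⟨U, hU, hE⟩ := exists_trace_eq A
  rw [← hE]; exact h U hU

lemma re_trace_le_of_le {U A : Matrix n n ℂ} {r : ℝ} (h : ‖U‖ ≤ r) :
    (U * A).trace.re ≤ r * traceNorm A :=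
  (re_trace_mul_le U A).trans (mul_le_mul_of_nonneg_right h (traceNorm_nonneg A))

lemma traceNorm_add_le (A B : Matrix n n ℂ) : traceNorm (A + B) ≤ traceNorm A + traceNorm B := by
  refine traceNorm_le_of fun U hU => ?_
  rw [Matrix.mul_add, trace_add, Complex.add_re]
  have h1 := re_trace_le_of_le (A := A) hU
  have h2 := re_trace_le_of_le (A := B) hU
  linarith

lemma traceNorm_mul_le (A B X : Matrix n n ℂ) :
    traceNorm (A * X * B) ≤ ‖A‖ * ‖B‖ * traceNorm X := by
  refine traceNorm_le_of fun U hU => ?_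
  have : (U * (A * X * B)).trace = ((B * U * A) * X).trace := by
    rw [← Matrix.mul_assoc, Matrix.trace_mul_comm]
    simp only [Matrix.mul_assoc]
  rw [this]
  apply re_trace_le_of_le
  calc ‖B * U * A‖ ≤ ‖B‖ * ‖U‖ * ‖A‖ := (norm_mul_le _ _).trans
        (mul_le_mul_of_nonneg_right (norm_mul_le _ _) (norm_nonneg _))
    _ ≤ ‖B‖ * 1 * ‖A‖ := by gcongr
    _ = _ := by ring

lemma norm_one_le : ‖(1 : Matrix n n ℂ)‖ ≤ 1 := by
  rw [← diagonal_one, l2_opNorm_diagonal]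
  exact (pi_norm_le_iff_of_nonneg zero_le_one).2 fun i => by simp

lemma traceNorm_mul_left_le (A X : Matrix n n ℂ) :
    traceNorm (A * X) ≤ ‖A‖ * traceNorm X := by
  have h := traceNorm_mul_le A 1 X
  rw [Matrix.mul_one] at h
  refine h.trans (mul_le_mul_of_nonneg_right ?_ (traceNorm_nonneg X))
  nlinarith [norm_one_le (n := n), norm_nonneg A]

lemma traceNorm_mul_right_le (B X : Matrix n n ℂ) :
    traceNorm (X * B) ≤ ‖B‖ * traceNorm X := by
  have h := traceNorm_mul_le 1 B X
  rw [Matrix.one_mul] at h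
  refine h.trans (mul_le_mul_of_nonneg_right ?_ (traceNorm_nonneg X))
  nlinarith [norm_one_le (n := n), norm_nonneg B]

lemma traceNorm_le_norm (X : Matrix n n ℂ) :
    traceNorm X ≤ ‖X‖ * traceNorm (1 : Matrix n n ℂ) := by
  simpa using traceNorm_mul_left_le X 1

lemma traceNorm_smul_le (z : ℂ) (X : Matrix n n ℂ) : traceNorm (z • X) ≤ ‖z‖ * traceNorm X := by
  refine traceNorm_le_of fun U hU => ?_
  have : U * (z • X) = (z • U) * X := by simp
  rw [this]
  apply re_trace_le_of_le
  rw [norm_smul]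
  nlinarith [norm_nonneg z]

lemma traceNorm_smul (z : ℂ) (X : Matrix n n ℂ) : traceNorm (z • X) = ‖z‖ * traceNorm X := by
  refine le_antisymm (traceNorm_smul_le z X) ?_
  by_cases hz : z = 0
  · simp [hz, traceNorm_nonneg]
  · have h := traceNorm_smul_le z⁻¹ (z • X)
    rw [smul_smul, inv_mul_cancel₀ hz, one_smul, norm_inv] at h
    have hz' : 0 < ‖z‖ := norm_pos_iff.2 hz
    calc ‖z‖ * traceNorm X ≤ ‖z‖ * (‖z‖⁻¹ * traceNorm (z • X)) := by gcongr
      _ = _ := by field_simp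

lemma traceNorm_zero : traceNorm (0 : Matrix n n ℂ) = 0 := by
  have := traceNorm_smul 0 (0 : Matrix n n ℂ)
  simpa using this

lemma eq_zero_of_traceNorm {X : Matrix n n ℂ} (h : traceNorm X = 0) : X = 0 := by
  ext i j
  have key : ∀ z : ℂ, (z * X i j).re ≤ 0 := by
    intro z
    have h1 := re_trace_mul_le (Matrix.single j i z) X
    rw [h, mul_zero] at h1
    have h2 : (Matrix.single j i z * X).trace = z * X i j := by
      rw [Matrix.trace_single_mul]
      simp
    rwa [h2] at h1
  have h1 := key (starRingEnd ℂ (X i j))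
  rw [mul_comm, Complex.mul_conj, Complex.ofReal_re] at h1
  exact Complex.normSq_eq_zero.1 (le_antisymm h1 (Complex.normSq_nonneg _))

lemma cp_norm_le {ι : Type*} [Fintype ι] (K : ι → Matrix n n ℂ) (U : Matrix n n ℂ) :
    ‖∑ j, (K j)ᴴ * U * K j‖ ≤ ‖U‖ * ‖∑ j, (K j)ᴴ * K j‖ := by
  set T : Matrix n n ℂ ≃⋆ₐ[ℂ] (EuclideanSpace ℂ n →L[ℂ] EuclideanSpace ℂ n) :=
    toEuclideanCLM (n := n) (𝕜 := ℂ) with hT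
  set S := ∑ j, (K j)ᴴ * K j with hS
  have hinner : ∀ (j : ι) (B : Matrix n n ℂ) (v w : EuclideanSpace ℂ n),
      ⟪v, T ((K j)ᴴ * B) w⟫_ℂ = ⟪T (K j) v, T B w⟫_ℂ := by
    intro j B v w
    rw [map_mul, ← Matrix.star_eq_conjTranspose, map_star, ContinuousLinearMap.star_eq_adjoint,
      mul_apply_eq_comp, ContinuousLinearMap.adjoint_inner_right]
  have hsq : ∀ w, ∑ j, ‖T (K j) w‖ ^ 2 ≤ ‖S‖ * ‖w‖ ^ 2 := by
    intro w
    have h1 : ⟪w, T S w⟫_ℂ = ((∑ j, ‖T (K j) w‖ ^ 2 : ℝ) : ℂ) := by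
      rw [hS, map_sum, _root_.sum_apply, inner_sum, Complex.ofReal_sum]
      refine Finset.sum_congr rfl fun j _ => ?_
      rw [hinner, inner_self_eq_norm_sq_to_K]
      simp
    calc ∑ j, ‖T (K j) w‖ ^ 2 = (⟪w, T S w⟫_ℂ).re := by rw [h1, Complex.ofReal_re]
      _ ≤ ‖⟪w, T S w⟫_ℂ‖ := Complex.re_le_norm _
      _ ≤ ‖w‖ * ‖T S w‖ := norm_inner_le_norm _ _
      _ ≤ ‖w‖ * (‖S‖ * ‖w‖) := by
          gcongr
          rw [← Matrix.l2_opNorm_toEuclideanCLM]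
          exact ContinuousLinearMap.le_opNorm _ _
      _ = _ := by ring
  rw [← Matrix.l2_opNorm_toEuclideanCLM (∑ j, (K j)ᴴ * U * K j)]
  refine ContinuousLinearMap.opNorm_le_bound _ (by positivity) fun w => ?_
  set R := ∑ j, (K j)ᴴ * U * K j with hR
  change ‖T R w‖ ≤ _
  set z := T R w with hz
  have hmain : ‖z‖ ^ 2 ≤ ‖U‖ * ‖S‖ * ‖w‖ * ‖z‖ := by
    have h1 : ((‖z‖ ^ 2 : ℝ) : ℂ) = ∑ j, ⟪T (K j) z, T U (T (K j) w)⟫_ℂ := by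
      have : ((‖z‖ ^ 2 : ℝ) : ℂ) = ⟪z, z⟫_ℂ := by
        rw [inner_self_eq_norm_sq_to_K]; simp
      rw [this]
      have hzz : z = ∑ j, T ((K j)ᴴ * U * K j) w := by
        rw [hz, hR, map_sum, _root_.sum_apply]
      conv_lhs => enter [3]; rw [hzz]
      rw [inner_sum]
      refine Finset.sum_congr rfl fun j _ => ?_
      rw [Matrix.mul_assoc, hinner, map_mul, mul_apply_eq_comp]
    have h2 : ‖z‖ ^ 2 ≤ ∑ j, ‖T (K j) z‖ * (‖U‖ * ‖T (K j) w‖) := by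
      calc ‖z‖ ^ 2 = ‖((‖z‖ ^ 2 : ℝ) : ℂ)‖ := by
            rw [Complex.norm_real, Real.norm_of_nonneg (by positivity)]
        _ ≤ ∑ j, ‖⟪T (K j) z, T U (T (K j) w)⟫_ℂ‖ := by rw [h1]; exact norm_sum_le _ _
        _ ≤ _ := by
          refine Finset.sum_le_sum fun j _ => (norm_inner_le_norm _ _).trans ?_
          gcongr
          rw [← Matrix.l2_opNorm_toEuclideanCLM]
          exact ContinuousLinearMap.le_opNorm _ _
    have h3 : ∑ j, ‖T (K j) z‖ * ‖T (K j) w‖ ≤ ‖S‖ * ‖w‖ * ‖z‖ := by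
      have hcs := Finset.sum_mul_sq_le_sq_mul_sq Finset.univ (fun j => ‖T (K j) z‖)
        (fun j => ‖T (K j) w‖)
      refine abs_le_of_sq_le_sq' (a := ∑ j, ‖T (K j) z‖ * ‖T (K j) w‖) ?_ (by positivity) |>.2
      refine hcs.trans ?_
      calc _ ≤ (‖S‖ * ‖z‖ ^ 2) * (‖S‖ * ‖w‖ ^ 2) := by
            gcongr
            · exact hsq z
            · exact hsq w
        _ = _ := by ring
    calc ‖z‖ ^ 2 ≤ ‖U‖ * ∑ j, ‖T (K j) z‖ * ‖T (K j) w‖ := by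
          rw [Finset.mul_sum]; refine h2.trans (le_of_eq ?_)
          exact Finset.sum_congr rfl fun j _ => by ring
      _ ≤ ‖U‖ * (‖S‖ * ‖w‖ * ‖z‖) := by gcongr
      _ = _ := by ring
  by_cases hz0 : ‖z‖ = 0
  · rw [hz0]; positivity
  · have : 0 < ‖z‖ := lt_of_le_of_ne (norm_nonneg _) (Ne.symm hz0)
    refine le_of_mul_le_mul_right ?_ this
    nlinarith

lemma traceNorm_cp_le {ι : Type*} [Fintype ι] (K : ι → Matrix n n ℂ) (X : Matrix n n ℂ) :
    traceNorm (∑ j, K j * X * (K j)ᴴ) ≤ ‖∑ j, (K j)ᴴ * K j‖ * traceNorm X := by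
  refine traceNorm_le_of fun U hU => ?_
  have : (U * ∑ j, K j * X * (K j)ᴴ).trace = ((∑ j, (K j)ᴴ * U * K j) * X).trace := by
    rw [Finset.mul_sum, Finset.sum_mul, trace_sum, trace_sum]
    refine Finset.sum_congr rfl fun j _ => ?_
    rw [← Matrix.mul_assoc, Matrix.trace_mul_comm]
    simp only [Matrix.mul_assoc]
  rw [this]
  apply re_trace_le_of_le
  refine (cp_norm_le K U).trans ?_
  nlinarith [norm_nonneg (∑ j, (K j)ᴴ * K j)]

/-- the effective non-Hermitian generator -/
noncomputable def effG {m : ℕ} (A : Matrix n n ℂ) (L : Fin m → Matrix n n ℂ) : Matrix n n ℂ :=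
  (-Complex.I) • A - ((1 : ℂ)/2) • ∑ j, (L j)ᴴ * L j

lemma effG_conj {m : ℕ} {A : Matrix n n ℂ} (hA : A.IsHermitian) (L : Fin m → Matrix n n ℂ) :
    (effG A L)ᴴ = Complex.I • A - ((1 : ℂ)/2) • ∑ j, (L j)ᴴ * L j := by
  rw [effG, conjTranspose_sub, conjTranspose_smul, conjTranspose_smul, conjTranspose_sum, hA.eq]
  simp

lemma lind_eq {m : ℕ} {A : Matrix n n ℂ} (hA : A.IsHermitian) (L : Fin m → Matrix n n ℂ)
    (X : Matrix n n ℂ) :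
    hamTerm A X + totalDissipator L X =
      effG A L * X + X * (effG A L)ᴴ + ∑ j, L j * X * (L j)ᴴ := by
  rw [effG_conj hA, effG]
  simp only [hamTerm, totalDissipator, dissipator, Finset.sum_sub_distrib, ← Finset.smul_sum,
    Finset.sum_add_distrib, ← Finset.sum_mul, ← Finset.mul_sum, sub_mul, mul_sub, smul_mul_assoc,
    mul_smul_comm, smul_sub, smul_add, neg_smul, neg_mul]
  abel

lemma lind_step {m : ℕ} {A : Matrix n n ℂ} (hA : A.IsHermitian) (L : Fin m → Matrix n n ℂ)
    (X : Matrix n n ℂ) {h : ℝ} (hh : 0 ≤ h) :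
    traceNorm (X + (h : ℂ) • (hamTerm A X + totalDissipator L X)) ≤
      (1 + h ^ 2 * (2 * ‖effG A L‖ ^ 2)) * traceNorm X := by
  set G := effG A L with hG
  let K : Option (Fin m) → Matrix n n ℂ := fun o => o.elim (1 + (h : ℂ) • G)
    (fun j => ((√h : ℝ) : ℂ) • L j)
  have hs : ((√h : ℝ) : ℂ) * ((√h : ℝ) : ℂ) = h := by
    rw [← Complex.ofReal_mul, Real.mul_self_sqrt hh]
  have hGG : G + Gᴴ + ∑ j, (L j)ᴴ * L j = 0 := by
    rw [hG, effG_conj hA, effG]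
    module
  have h1 : X + (h : ℂ) • (hamTerm A X + totalDissipator L X) =
      (∑ o, K o * X * (K o)ᴴ) + (-(h : ℂ) ^ 2) • (G * X * Gᴴ) := by
    rw [lind_eq hA, Fintype.sum_option]
    simp only [K, Option.elim_none, Option.elim_some, conjTranspose_add, conjTranspose_one,
      conjTranspose_smul, smul_mul_assoc, mul_smul_comm, smul_smul, Complex.star_def,
      Complex.conj_ofReal, hs, ← Finset.smul_sum, add_mul, mul_add, one_mul, mul_one]
    rw [← hG]
    module
  have h2 : ∑ o, (K o)ᴴ * K o = 1 + ((h : ℂ) ^ 2) • (Gᴴ * G) := by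
    rw [Fintype.sum_option]
    simp only [K, Option.elim_none, Option.elim_some, conjTranspose_add, conjTranspose_one,
      conjTranspose_smul, smul_mul_assoc, mul_smul_comm, smul_smul, Complex.star_def,
      Complex.conj_ofReal, hs, ← Finset.smul_sum, add_mul, mul_add, one_mul, mul_one]
    have : ∑ j, (L j)ᴴ * L j = -(G + Gᴴ) := by
      rw [eq_neg_iff_add_eq_zero, ← hGG]; abel
    rw [this]
    module
  have h3 : ‖∑ o, (K o)ᴴ * K o‖ ≤ 1 + h ^ 2 * ‖G‖ ^ 2 := by
    rw [h2]
    refine (norm_add_le _ _).trans (add_le_add norm_one_le ?_)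
    rw [norm_smul, norm_pow, Complex.norm_real, Real.norm_of_nonneg hh,
      l2_opNorm_conjTranspose_mul_self]
    exact le_of_eq (by ring)
  have h4 : traceNorm ((-(h : ℂ) ^ 2) • (G * X * Gᴴ)) ≤ h ^ 2 * ‖G‖ ^ 2 * traceNorm X := by
    rw [traceNorm_smul, norm_neg, norm_pow, Complex.norm_real, Real.norm_of_nonneg hh]
    have := traceNorm_mul_le G Gᴴ X
    rw [l2_opNorm_conjTranspose] at this
    calc _ ≤ h ^ 2 * (‖G‖ * ‖G‖ * traceNorm X) := by gcongr
      _ = _ := by ring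
  rw [h1]
  refine (traceNorm_add_le _ _).trans ?_
  have h5 := (traceNorm_cp_le K X).trans (mul_le_mul_of_nonneg_right h3 (traceNorm_nonneg X))
  nlinarith

lemma hasDerivAt_matrix {f : ℝ → Matrix n n ℂ} {f' : Matrix n n ℂ} {t : ℝ}
    (h : ∀ i j, HasDerivAt (fun u => f u i j) (f' i j) t) : HasDerivAt f f' t := by
  have e : ∀ X : Matrix n n ℂ, X = ∑ i, ∑ j, X i j • Matrix.single i j (1 : ℂ) := by
    intro X
    conv_lhs => rw [matrix_eq_sum_single X]
    simp
  have h1 : HasDerivAt (fun u => ∑ i, ∑ j, f u i j • Matrix.single i j (1 : ℂ))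
      (∑ i, ∑ j, f' i j • Matrix.single i j (1 : ℂ)) t :=
    HasDerivAt.fun_sum fun i _ => HasDerivAt.fun_sum fun j _ => (h i j).smul_const _
  rw [← e f'] at h1
  exact h1.congr_of_eventuallyEq (Filter.Eventually.of_forall fun u => e (f u))

noncomputable def entryCLM (i j : n) : Matrix n n ℂ →L[ℝ] ℂ :=
  LinearMap.toContinuousLinearMap
    { toFun := fun X => X i j, map_add' := fun _ _ => rfl, map_smul' := fun _ _ => rfl }

lemma hasDerivAt_entry {f : ℝ → Matrix n n ℂ} {f' : Matrix n n ℂ} {t : ℝ}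
    (h : HasDerivAt f f' t) (i j : n) : HasDerivAt (fun u => f u i j) (f' i j) t :=
  (entryCLM i j).hasFDerivAt.comp_hasDerivAt t h

lemma traceNorm_le_add (A B : Matrix n n ℂ) : traceNorm A ≤ traceNorm B + traceNorm (A - B) := by
  have := traceNorm_add_le B (A - B)
  rwa [add_sub_cancel] at this

lemma continuous_traceNorm : Continuous (traceNorm : Matrix n n ℂ → ℝ) := by
  have h : LipschitzWith (Real.toNNReal (traceNorm (1 : Matrix n n ℂ)))
      (traceNorm : Matrix n n ℂ → ℝ) := by
    apply LipschitzWith.of_le_add_mul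
    intro x y
    rw [Real.coe_toNNReal _ (traceNorm_nonneg _), dist_eq_norm]
    have := traceNorm_le_add x y
    have := traceNorm_le_norm (x - y)
    linarith
  exact h.continuous

/-- The trace norm is nonincreasing along solutions. -/
lemma traceNorm_mono {m : ℕ} {A : ℝ → Matrix n n ℂ} (hA : ∀ t, (A t).IsHermitian)
    (L : Fin m → Matrix n n ℂ) {s : ℝ} {x : ℝ → Matrix n n ℂ}
    (hx : ∀ t, s ≤ t → HasDerivAt x (hamTerm (A t) (x t) + totalDissipator L (x t)) t)
    {t : ℝ} (hst : s ≤ t) : traceNorm (x t) ≤ traceNorm (x s) := by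
  refine image_le_of_liminf_slope_right_le_deriv_boundary (f := fun t => traceNorm (x t))
    (a := s) (b := t) (B := fun _ => traceNorm (x s)) (B' := fun _ => 0) ?_ le_rfl
    continuousOn_const (fun _ _ => hasDerivWithinAt_const _ _ _) ?_ ⟨hst, le_rfl⟩
  · intro u hu
    exact (continuous_traceNorm.continuousAt.comp (hx u hu.1).continuousAt).continuousWithinAt
  · intro u hu r hr
    apply Filter.Eventually.frequently
    set C := 2 * ‖effG (A u) L‖ ^ 2 * traceNorm (x u) with hC
    have hC0 : 0 ≤ C := by have := traceNorm_nonneg (x u); positivity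
    set N := traceNorm (1 : Matrix n n ℂ) with hN
    have hN0 : 0 ≤ N := traceNorm_nonneg _
    set y := hamTerm (A u) (x u) + totalDissipator L (x u) with hy
    have hε : 0 < r / (2 * (N + 1)) := by positivity
    have ho := (hasDerivAt_iff_isLittleO.1 (hx u hu.1)).def hε
    have ho' := ho.filter_mono (nhdsWithin_le_nhds (s := Set.Ioi u))
    have hnear : ∀ᶠ z in nhdsWithin u (Set.Ioi u), z < u + r / (2 * (C + 1)) := by
      have : u < u + r / (2 * (C + 1)) := by
        have : 0 < r / (2 * (C + 1)) := by positivity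
        linarith
      exact nhdsWithin_le_nhds (eventually_lt_nhds this)
    filter_upwards [ho', hnear, self_mem_nhdsWithin] with z hz1 hz2 hz3
    have hh : 0 < z - u := sub_pos.2 hz3
    rw [slope_def_field, div_lt_iff₀ hh]
    have e1 := lind_step (hA u) L (x u) hh.le
    have e2 := traceNorm_le_add (x z) (x u + ((z - u : ℝ) : ℂ) • y)
    have e3 : x z - (x u + ((z - u : ℝ) : ℂ) • y) = x z - x u - (z - u) • y := by
      rw [Complex.coe_smul]; abel
    rw [e3] at e2
    have e4 := traceNorm_le_norm (x z - x u - (z - u) • y)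
    rw [Real.norm_of_nonneg hh.le] at hz1
    have e5 : ‖x z - x u - (z - u) • y‖ * N ≤ r / (2 * (N + 1)) * (z - u) * N := by gcongr
    have e6 : r / (2 * (N + 1)) * (z - u) * N ≤ r / 2 * (z - u) := by
      have : r / (2 * (N + 1)) * (z - u) * N = r / 2 * (z - u) * (N / (N + 1)) := by field_simp
      rw [this]
      have : N / (N + 1) ≤ 1 := by rw [div_le_one (by positivity)]; linarith
      have : 0 ≤ r / 2 * (z - u) := by positivity
      nlinarith
    have e7 : (z - u) * C < r / 2 := by
      have : (z - u) * (C + 1) < r / 2 := by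
        have : z - u < r / (2 * (C + 1)) := by linarith
        rw [lt_div_iff₀ (by positivity)] at this
        linarith
      nlinarith
    have e8 : (1 + (z - u) ^ 2 * (2 * ‖effG (A u) L‖ ^ 2)) * traceNorm (x u) =
        traceNorm (x u) + (z - u) * ((z - u) * C) := by rw [hC]; ring
    nlinarith

/-- the Lindbladian with fixed Hamiltonian as a continuous real-linear map -/
noncomputable def lindCLM {m : ℕ} (A : Matrix n n ℂ) (L : Fin m → Matrix n n ℂ) :
    Matrix n n ℂ →L[ℝ] Matrix n n ℂ :=
  LinearMap.toContinuousLinearMap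
    { toFun := fun X => hamTerm A X + totalDissipator L X
      map_add' := by
        intro x y
        have h : ∀ j, dissipator (L j) (x + y) = dissipator (L j) x + dissipator (L j) y := by
          intro j
          simp only [dissipator, mul_add, add_mul, smul_add]; abel
        simp only [hamTerm, totalDissipator, h, Finset.sum_add_distrib, mul_add, add_mul]
        module
      map_smul' := by
        intro r x
        have h : ∀ j, dissipator (L j) (r • x) = r • dissipator (L j) x := by
          intro j
          simp only [dissipator, mul_smul_comm, smul_mul_assoc, ← smul_add, smul_sub]
          rw [smul_comm r]
        simp only [hamTerm, totalDissipator, h, ← Finset.smul_sum, mul_smul_comm, smul_mul_assoc,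
          ← smul_sub, RingHom.id_apply, smul_add]
        rw [smul_comm r] }

lemma lindCLM_apply {m : ℕ} (A : Matrix n n ℂ) (L : Fin m → Matrix n n ℂ) (X : Matrix n n ℂ) :
    lindCLM A L X = hamTerm A X + totalDissipator L X := rfl

/-- frozen propagator -/
noncomputable def prop {m : ℕ} (A : Matrix n n ℂ) (L : Fin m → Matrix n n ℂ) (τ : ℝ) :
    Matrix n n ℂ →L[ℝ] Matrix n n ℂ := NormedSpace.exp (τ • lindCLM A L)

lemma prop_zero {m : ℕ} (A : Matrix n n ℂ) (L : Fin m → Matrix n n ℂ) (X : Matrix n n ℂ) :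
    prop A L 0 X = X := by
  have h : (0 : ℝ) • lindCLM A L = 0 :=
    ContinuousLinearMap.ext fun Y => zero_smul ℝ (lindCLM A L Y)
  rw [prop, h, NormedSpace.exp_zero]
  rfl

lemma prop_hasDerivAt {m : ℕ} (A : Matrix n n ℂ) (L : Fin m → Matrix n n ℂ) (τ : ℝ) :
    HasDerivAt (prop A L) (prop A L τ * lindCLM A L) τ :=
  hasDerivAt_exp_smul_const (lindCLM A L) τ

lemma prop_hasDerivAt' {m : ℕ} (A : Matrix n n ℂ) (L : Fin m → Matrix n n ℂ) (X : Matrix n n ℂ)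
    (τ : ℝ) : HasDerivAt (fun u => prop A L u X) (lindCLM A L (prop A L τ X)) τ := by
  have h : HasDerivAt (prop A L) (lindCLM A L * prop A L τ) τ :=
    hasDerivAt_exp_smul_const' (lindCLM A L) τ
  have := h.clm_apply (hasDerivAt_const τ X)
  simpa using this

lemma prop_le {m : ℕ} {A : Matrix n n ℂ} (hA : A.IsHermitian) (L : Fin m → Matrix n n ℂ)
    (X : Matrix n n ℂ) {τ : ℝ} (hτ : 0 ≤ τ) : traceNorm (prop A L τ X) ≤ traceNorm X := by
  have := traceNorm_mono (A := fun _ => A) (fun _ => hA) L (s := 0) (x := fun u => prop A L u X)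
    (fun t _ => prop_hasDerivAt' A L X t) hτ
  simpa [prop_zero] using this

open scoped MatrixOrder in
lemma posSemidef_add_norm {X : Matrix n n ℂ} (hX : X.IsHermitian) :
    (X + (‖X‖ : ℂ) • (1 : Matrix n n ℂ)).PosSemidef := by
  have h := IsSelfAdjoint.neg_algebraMap_norm_le_self (a := X) hX
  rw [Matrix.le_iff, sub_neg_eq_add, Algebra.algebraMap_eq_smul_one] at h
  rwa [Complex.coe_smul]

lemma prop_contr {m : ℕ} {A : Matrix n n ℂ} (L : Fin m → Matrix n n ℂ) {K γ : ℝ}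
    (hc : ExpContractiveWith (fun _ x => hamTerm A x + totalDissipator L x) K γ)
    {X : Matrix n n ℂ} (hX : X.IsHermitian) (htr : X.trace = 0) {τ : ℝ} (hτ : 0 ≤ τ) :
    traceNorm (prop A L τ X) ≤ K * Real.exp (-γ * τ) * traceNorm X := by
  by_cases hX0 : X = 0
  · subst hX0; simp [traceNorm_zero]
  have hne : Nonempty n := by
    by_contra hn
    rw [not_nonempty_iff] at hn
    exact hX0 (Subsingleton.elim _ _)
  have hN : 0 < ‖X‖ := norm_pos_iff.2 hX0
  have hcard : 0 < (Fintype.card n : ℝ) := by exact_mod_cast Fintype.card_pos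
  set k : ℝ := (‖X‖ * Fintype.card n)⁻¹ with hk
  have hk0 : 0 < k := by positivity
  have hkr : (k : ℂ) * ((‖X‖ : ℂ) * (Fintype.card n : ℂ)) = 1 := by
    have : k * (‖X‖ * Fintype.card n) = 1 := by rw [hk]; field_simp
    exact_mod_cast this
  set R : Matrix n n ℂ := (k : ℂ) • (X + (‖X‖ : ℂ) • (1 : Matrix n n ℂ)) with hR
  set S : Matrix n n ℂ := (k : ℂ) • ((‖X‖ : ℂ) • (1 : Matrix n n ℂ)) with hS
  have hkc : (0 : ℂ) ≤ (k : ℂ) := by exact_mod_cast hk0.le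
  have hNc : (0 : ℂ) ≤ (‖X‖ : ℂ) := by exact_mod_cast hN.le
  have hRd : IsDensity R := by
    refine ⟨(posSemidef_add_norm hX).smul hkc, ?_⟩
    rw [hR, trace_smul, trace_add, htr, trace_smul, trace_one, zero_add]
    exact hkr
  have hSd : IsDensity S := by
    refine ⟨(PosSemidef.one.smul hNc).smul hkc, ?_⟩
    rw [hS, trace_smul, trace_smul, trace_one]
    exact hkr
  have hsol : ∀ Y : Matrix n n ℂ,
      IsSolution (fun _ x => hamTerm A x + totalDissipator L x) 0 (fun u => prop A L u Y) := by
    intro Y t _ i j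
    exact hasDerivAt_entry (prop_hasDerivAt' A L Y t) i j
  have h := hc 0 τ le_rfl hτ _ _ (hsol R) (hsol S) (by simpa [prop_zero] using hRd)
    (by simpa [prop_zero] using hSd)
  have hd : R - S = k • X := by rw [hR, hS, ← smul_sub, add_sub_cancel_right, Complex.coe_smul]
  simp only [prop_zero, ← map_sub, hd, map_smul, sub_zero] at h
  rw [← Complex.coe_smul, ← Complex.coe_smul, traceNorm_smul, traceNorm_smul, Complex.norm_real,
    Real.norm_of_nonneg hk0.le] at h
  have : k * traceNorm (prop A L τ X) ≤ k * (K * Real.exp (-γ * τ) * traceNorm X) := by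
    calc _ ≤ _ := h
      _ = _ := by ring
  exact le_of_mul_le_mul_left this hk0

lemma hamTerm_isHermitian {A X : Matrix n n ℂ} (hA : A.IsHermitian) (hX : X.IsHermitian) :
    (hamTerm A X).IsHermitian := by
  rw [Matrix.IsHermitian, hamTerm, conjTranspose_smul, conjTranspose_sub, conjTranspose_mul,
    conjTranspose_mul, hA.eq, hX.eq]
  simp
  rw [← smul_neg, neg_sub]

lemma hamTerm_trace (A X : Matrix n n ℂ) : (hamTerm A X).trace = 0 := by
  rw [hamTerm, trace_smul, trace_sub, Matrix.trace_mul_comm, sub_self, smul_zero]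

lemma hamTerm_traceNorm (A X : Matrix n n ℂ) :
    traceNorm (hamTerm A X) ≤ 2 * ‖A‖ * traceNorm X := by
  rw [hamTerm, traceNorm_smul, norm_neg, Complex.norm_I, one_mul]
  have h1 := traceNorm_add_le (A * X) ((-1 : ℂ) • (X * A))
  rw [traceNorm_smul] at h1
  have h2 : A * X + (-1 : ℂ) • (X * A) = A * X - X * A := by module
  rw [h2] at h1
  have h3 := traceNorm_mul_left_le A X
  have h4 := traceNorm_mul_right_le A X
  simp at h1
  linarith

lemma lind_trace {m : ℕ} (A : Matrix n n ℂ) (L : Fin m → Matrix n n ℂ) (X : Matrix n n ℂ) :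
    (hamTerm A X + totalDissipator L X).trace = 0 := by
  rw [trace_add, hamTerm_trace, zero_add, totalDissipator, trace_sum]
  refine Finset.sum_eq_zero fun j _ => ?_
  rw [dissipator, trace_sub, trace_smul, trace_add]
  have h1 : (L j * X * (L j)ᴴ).trace = ((L j)ᴴ * L j * X).trace := by
    rw [Matrix.trace_mul_comm, ← Matrix.mul_assoc]
  have h2 : (X * ((L j)ᴴ * L j)).trace = ((L j)ᴴ * L j * X).trace := Matrix.trace_mul_comm _ _
  rw [h1, h2, smul_eq_mul]; ring

lemma lind_conj {m : ℕ} {A : Matrix n n ℂ} (hA : A.IsHermitian) (L : Fin m → Matrix n n ℂ)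
    (X : Matrix n n ℂ) :
    (hamTerm A X + totalDissipator L X)ᴴ = hamTerm A Xᴴ + totalDissipator L Xᴴ := by
  rw [lind_eq hA, lind_eq hA]
  simp only [conjTranspose_add, conjTranspose_mul, conjTranspose_sum, conjTranspose_conjTranspose,
    Matrix.mul_assoc]
  abel

lemma sol_hermitian {m : ℕ} {A : ℝ → Matrix n n ℂ} (hA : ∀ t, (A t).IsHermitian)
    (L : Fin m → Matrix n n ℂ) {s : ℝ} {x : ℝ → Matrix n n ℂ}
    (hx : ∀ t, s ≤ t → HasDerivAt x (hamTerm (A t) (x t) + totalDissipator L (x t)) t)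
    (h0 : (x s).IsHermitian) {t : ℝ} (hst : s ≤ t) : (x t).IsHermitian := by
  have hd : ∀ t, s ≤ t → HasDerivAt (fun u => x u - (x u)ᴴ)
      (hamTerm (A t) (x t - (x t)ᴴ) + totalDissipator L (x t - (x t)ᴴ)) t := by
    intro t ht
    have h1 := hx t ht
    have h2 : HasDerivAt (fun u => (x u)ᴴ) ((hamTerm (A t) (x t) + totalDissipator L (x t))ᴴ) t := by
      refine hasDerivAt_matrix fun i j => ?_
      exact (hasDerivAt_entry h1 j i).star
    rw [lind_conj (hA t)] at h2
    have h3 := h1.sub h2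
    rw [← lindCLM_apply, ← lindCLM_apply, ← map_sub] at h3
    exact h3
  have h := traceNorm_mono hA L hd hst
  simp only [h0.eq, sub_self, traceNorm_zero] at h
  have := eq_zero_of_traceNorm (le_antisymm h (traceNorm_nonneg _))
  exact (sub_eq_zero.1 this).symm

noncomputable def reTraceCLM (U : Matrix n n ℂ) : Matrix n n ℂ →L[ℝ] ℝ :=
  LinearMap.toContinuousLinearMap
    { toFun := fun X => (U * X).trace.re
      map_add' := fun x y => by simp [mul_add]
      map_smul' := fun r x => by simp }

noncomputable def traceCLM : Matrix n n ℂ →L[ℝ] ℂ :=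
  LinearMap.toContinuousLinearMap
    { toFun := fun X => X.trace
      map_add' := fun x y => by simp
      map_smul' := fun r x => by simp }

lemma sol_trace {m : ℕ} {A : ℝ → Matrix n n ℂ} 
    (L : Fin m → Matrix n n ℂ) {s : ℝ} {x : ℝ → Matrix n n ℂ}
    (hx : ∀ t, s ≤ t → HasDerivAt x (hamTerm (A t) (x t) + totalDissipator L (x t)) t)
    {t : ℝ} (hst : s ≤ t) : (x t).trace = (x s).trace := by
  have hd : ∀ t, s ≤ t → HasDerivAt (fun u => (x u).trace) 0 t := by
    intro t ht
    have := traceCLM.hasFDerivAt.comp_hasDerivAt t (hx t ht)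
    have e : traceCLM (hamTerm (A t) (x t) + totalDissipator L (x t)) = 0 := lind_trace _ _ _
    rw [e] at this
    exact this
  exact constant_of_has_deriv_right_zero (f := fun u => (x u).trace) (a := s) (b := t)
    (fun u hu => (hd u hu.1).continuousAt.continuousWithinAt)
    (fun u hu => (hd u hu.1).hasDerivWithinAt) t ⟨hst, le_rfl⟩

lemma hasDerivAt_mul_abs_half (y : ℝ) : HasDerivAt (fun v : ℝ => v * |v| / 2) |y| y := by
  rcases lt_trichotomy y 0 with h | h | h
  · have h1 : HasDerivAt (fun v : ℝ => v * (-v) / 2) |y| y := by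
      have := ((hasDerivAt_id y).mul (hasDerivAt_id y).neg).div_const 2
      refine this.congr_deriv ?_
      rw [abs_of_neg h]; simp
    refine h1.congr_of_eventuallyEq ?_
    filter_upwards [eventually_lt_nhds h] with v hv
    rw [abs_of_neg hv]
  · subst h
    rw [hasDerivAt_iff_isLittleO]
    simp only [abs_zero, mul_zero, zero_div, sub_zero, smul_zero]
    have h2 : (fun v : ℝ => v * |v| / 2) =O[nhds 0] fun v : ℝ => v ^ 2 := by
      refine Asymptotics.IsBigO.of_bound 1 (Filter.Eventually.of_forall fun v => ?_)
      simp only [norm_div, norm_mul, Real.norm_eq_abs, abs_abs, abs_pow, one_mul]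
      have := abs_nonneg v
      norm_num
      nlinarith [mul_nonneg this this]
    exact h2.trans_isLittleO (Asymptotics.isLittleO_pow_id one_lt_two)
  · have h1 : HasDerivAt (fun v : ℝ => v * v / 2) |y| y := by
      have := ((hasDerivAt_id y).mul (hasDerivAt_id y)).div_const 2
      refine this.congr_deriv ?_
      rw [abs_of_pos h]; simp
    refine h1.congr_of_eventuallyEq ?_
    filter_upwards [eventually_gt_nhds h] with v hv
    rw [abs_of_pos hv]

lemma scalar_window {f f' : ℝ → ℝ} {a b T γ M : ℝ} (ha : 0 ≤ a) (hb : 0 ≤ b) (haT : a ≤ T)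
    (hbT : b ≤ T) (hγ : 0 < γ) (hM : 0 ≤ M)
    (hf : ∀ v, 0 ≤ v → v ≤ T → HasDerivAt f (f' v) v)
    (h1 : ∀ v, 0 ≤ v → v ≤ T → f' v ≤ M * |v - a|)
    (h2 : ∀ v, 0 ≤ v → v ≤ T → f' v ≤ M * (|v - a| * Real.exp (γ * b - γ * v))) :
    f T - f 0 ≤ M * (a ^ 2 - a * b + b ^ 2 / 2 + (b - a) / γ + 1 / γ ^ 2) := by
  have hQ : ∀ v, HasDerivAt (fun v : ℝ => (v - a) * |v - a| / 2) |v - a| v := by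
    intro v
    have := (hasDerivAt_mul_abs_half (v - a)).comp_sub_const v a
    exact this
  have p1 : f b ≤ f 0 + M * ((b - a) * |b - a| / 2 - (0 - a) * |0 - a| / 2) := by
    have hB : ∀ v, HasDerivAt
        (fun v => f 0 + M * ((v - a) * |v - a| / 2 - (0 - a) * |0 - a| / 2)) (M * |v - a|) v :=
      fun v => (((hQ v).sub_const _).const_mul M).const_add _
    refine image_le_of_deriv_right_le_deriv_boundary (f := f) (f' := f') (a := 0) (b := b)
      (fun v hv => (hf v hv.1 (hv.2.trans hbT)).continuousAt.continuousWithinAt)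
      (fun v hv => (hf v hv.1 (hv.2.le.trans hbT)).hasDerivWithinAt) ?_
      (fun v _ => (hB v).continuousAt.continuousWithinAt)
      (fun v _ => (hB v).hasDerivWithinAt) 
      (fun v hv => h1 v hv.1 (hv.2.le.trans hbT)) ⟨hb, le_rfl⟩
    simp
  have hE : ∀ v, HasDerivAt (fun v : ℝ => -((v - a) / γ + 1 / γ ^ 2) * Real.exp (γ * b - γ * v))
      ((v - a) * Real.exp (γ * b - γ * v)) v := by
    intro v
    have e1 : HasDerivAt (fun v : ℝ => Real.exp (γ * b - γ * v))
        (Real.exp (γ * b - γ * v) * (-(γ * 1))) v :=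
      (((hasDerivAt_id v).const_mul γ).const_sub (γ * b)).exp
    have e2 : HasDerivAt (fun v : ℝ => -((v - a) / γ + 1 / γ ^ 2)) (-(1 / γ)) v :=
      ((((hasDerivAt_id v).sub_const a).div_const γ).add_const _).neg
    refine (e2.mul e1).congr_deriv ?_
    field_simp
    ring
  have hR : ∀ v, HasDerivAt (fun v : ℝ => (v - a) ^ 2 / 2) (v - a) v := by
    intro v
    have := (((hasDerivAt_id v).sub_const a).pow 2).div_const 2
    refine this.congr_deriv ?_
    simp
  set W : ℝ → ℝ := fun v => -((v - a) / γ + 1 / γ ^ 2) * Real.exp (γ * b - γ * v) +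
    ((v - a) * |v - a| / 2 - (v - a) ^ 2 / 2) with hW
  have hW' : ∀ v, HasDerivAt W ((v - a) * Real.exp (γ * b - γ * v) + (|v - a| - (v - a))) v :=
    fun v => (hE v).add ((hQ v).sub (hR v))
  have p2 : f T ≤ f b + M * (W T - W b) := by
    have hB : ∀ v, HasDerivAt
        (fun v => f b + M * (W v - W b))
          (M * ((v - a) * Real.exp (γ * b - γ * v) + (|v - a| - (v - a)))) v :=
      fun v => (((hW' v).sub_const _).const_mul M).const_add _
    refine image_le_of_deriv_right_le_deriv_boundary (f := f) (f' := f') (a := b) (b := T)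
      (fun v hv => (hf v (hb.trans hv.1) hv.2).continuousAt.continuousWithinAt)
      (fun v hv => (hf v (hb.trans hv.1) hv.2.le).hasDerivWithinAt) ?_
      (fun v _ => (hB v).continuousAt.continuousWithinAt)
      (fun v _ => (hB v).hasDerivWithinAt) ?_ ⟨hbT, le_rfl⟩
    · simp
    · intro v hv
      refine (h2 v (hb.trans hv.1) hv.2.le).trans ?_
      gcongr
      have he : Real.exp (γ * b - γ * v) ≤ 1 := by
        rw [Real.exp_le_one_iff]; nlinarith [hv.1]
      have := le_abs_self (v - a)
      nlinarith
  have hWT : W T ≤ 0 := by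
    simp only [hW]
    rw [abs_of_nonneg (by linarith : 0 ≤ T - a)]
    have : 0 ≤ ((T - a) / γ + 1 / γ ^ 2) * Real.exp (γ * b - γ * T) := by
      have : 0 ≤ T - a := by linarith
      positivity
    nlinarith
  have hWb : W b = -((b - a) / γ + 1 / γ ^ 2) + ((b - a) * |b - a| / 2 - (b - a) ^ 2 / 2) := by
    simp [hW]
  have h0 : (0 - a) * |0 - a| / 2 = - a ^ 2 / 2 := by
    rw [zero_sub, abs_neg, abs_of_nonneg ha]; ring
  have hMW : M * W T ≤ 0 := mul_nonpos_of_nonneg_of_nonpos hM hWT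
  rw [hWb] at p2
  rw [h0] at p1
  linarith

lemma norm_sub_le_of_deriv {H H' : ℝ → Matrix n n ℂ}
    (hd : ∀ t i j, HasDerivAt (fun u => H u i j) (H' t i j) t) {c : ℝ}
    (hb : ∀ t, 0 ≤ t → ‖H' t‖ ≤ c) {u v : ℝ} (hu : 0 ≤ u) (hv : 0 ≤ v) :
    ‖H u - H v‖ ≤ c * |u - v| := by
  have := (convex_Ici (0 : ℝ)).norm_image_sub_le_of_norm_hasDerivWithin_le (f := H) (f' := H')
    (C := c) (fun x _ => (hasDerivAt_matrix (hd x)).hasDerivWithinAt) (fun x hx => hb x hx)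
    (x := v) (y := u) hv hu
  simpa using this

lemma window {m : ℕ} (L : Fin m → Matrix n n ℂ) {H H' : ℝ → Matrix n n ℂ}
    (hHherm : ∀ t, (H t).IsHermitian)
    (hd : ∀ t i j, HasDerivAt (fun u => H u i j) (H' t i j) t)
    {K0 γ0 : ℝ} (hK0 : 1 ≤ K0) (hγ0 : 0 < γ0)
    (hinst : ∀ t0, 0 ≤ t0 →
      ExpContractiveWith (fun _ x => hamTerm (H t0) x + totalDissipator L x) K0 γ0)
    {c : ℝ} (hc : 0 ≤ c) (hb : ∀ t, 0 ≤ t → ‖H' t‖ ≤ c)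
    {T : ℝ} (hT1 : (Real.log K0 + 1) / (2 * γ0) ≤ T) (hT2 : Real.log K0 / γ0 ≤ T)
    {s : ℝ} (hs : 0 ≤ s) {x : ℝ → Matrix n n ℂ}
    (hx : ∀ t, s ≤ t → HasDerivAt x (hamTerm (H t) (x t) + totalDissipator L (x t)) t)
    (hherm : (x s).IsHermitian) (htr : (x s).trace = 0) :
    traceNorm (x (s + T)) ≤
      (c / γ0 ^ 2 * (3 / 2 + Real.log K0 + Real.log K0 ^ 2 / 2) +
        K0 * Real.exp (-γ0 * T)) * traceNorm (x s) := by
  set l := Real.log K0 with hl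
  have hl0 : 0 ≤ l := Real.log_nonneg hK0
  have hKexp : K0 = Real.exp l := (Real.exp_log (by linarith)).symm
  set a := (l + 1) / (2 * γ0) with ha
  set b := l / γ0 with hbdef
  have ha0 : 0 ≤ a := by positivity
  have hb0 : 0 ≤ b := by positivity
  have hT0 : 0 ≤ T := hb0.trans hT2
  have ht0 : 0 ≤ s + T - a := by linarith
  set A := H (s + T - a) with hA
  set N := traceNorm (x s) with hN
  have hN0 : 0 ≤ N := traceNorm_nonneg _
  refine traceNorm_le_of fun U hU => ?_
  set f : ℝ → ℝ := fun v => -(reTraceCLM U (prop A L v (x (s + T - v)))) with hf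
  set y : ℝ → Matrix n n ℂ := fun v => hamTerm (H (s + T - v) - A) (x (s + T - v)) with hy
  have hderiv : ∀ v, 0 ≤ v → v ≤ T → HasDerivAt f (reTraceCLM U (prop A L v (y v))) v := by
    intro v hv0 hvT
    have h1 : HasDerivAt (fun v => x (s + T - v))
        (-(lindCLM (H (s + T - v)) L (x (s + T - v)))) v :=
      (hx (s + T - v) (by linarith)).comp_const_sub (s + T) v
    have h2 := (prop_hasDerivAt A L v).clm_apply h1
    have h3 := ((reTraceCLM U).hasFDerivAt.comp_hasDerivAt v h2).neg
    refine h3.congr_deriv ?_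
    rw [← map_neg]
    congr 1
    rw [mul_apply_eq_comp, ← map_add, ← map_neg]
    congr 1
    simp only [lindCLM_apply, hy, hamTerm, sub_mul, mul_sub]
    module
  have hre : ∀ X : Matrix n n ℂ, reTraceCLM U X ≤ traceNorm X := fun X => by
    have := re_trace_le_of_le (A := X) hU
    rw [one_mul] at this
    exact this
  have hyn : ∀ v, 0 ≤ v → v ≤ T → traceNorm (y v) ≤ 2 * c * N * |v - a| := by
    intro v hv0 hvT
    have h1 := hamTerm_traceNorm (H (s + T - v) - A) (x (s + T - v))
    have h2 : ‖H (s + T - v) - A‖ ≤ c * |v - a| := by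
      have := norm_sub_le_of_deriv hd hb (u := s + T - v) (v := s + T - a) (by linarith) ht0
      have e : s + T - v - (s + T - a) = -(v - a) := by ring
      rwa [e, abs_neg] at this
    have h3 : traceNorm (x (s + T - v)) ≤ N := traceNorm_mono hHherm L hx (by linarith)
    calc traceNorm (y v) ≤ _ := h1
      _ ≤ 2 * (c * |v - a|) * N := by
          have := traceNorm_nonneg (x (s + T - v))
          gcongr
      _ = _ := by ring
  have key := scalar_window (f := f) (f' := fun v => reTraceCLM U (prop A L v (y v)))
    (M := 2 * c * N) ha0 hb0 hT1 hT2 hγ0 (by positivity) hderiv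
    (fun v hv0 hvT => (hre _).trans ((prop_le (hHherm _) L _ hv0).trans (hyn v hv0 hvT)))
    (fun v hv0 hvT => by
      refine (hre _).trans ((prop_contr L (hinst _ ht0) ?_ ?_ hv0).trans ?_)
      · exact hamTerm_isHermitian ((hHherm _).sub (hHherm _))
          (sol_hermitian hHherm L hx hherm (by linarith))
      · exact hamTerm_trace _ _
      · have e : Real.exp (γ0 * b - γ0 * v) = K0 * Real.exp (-γ0 * v) := by
          rw [hKexp, ← Real.exp_add]
          congr 1
          rw [hbdef]; field_simp; ring
        rw [e]
        calc K0 * Real.exp (-γ0 * v) * traceNorm (y v)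
            ≤ K0 * Real.exp (-γ0 * v) * (2 * c * N * |v - a|) := by
              have : 0 ≤ K0 := by linarith
              have := hyn v hv0 hvT
              gcongr
          _ = _ := by ring)
  have hf0 : f 0 = -((U * x (s + T)).trace.re) := by
    simp only [hf, prop_zero, sub_zero]; rfl
  have hfT : -f T ≤ K0 * Real.exp (-γ0 * T) * N := by
    simp only [hf, neg_neg, add_sub_cancel_right]
    exact (hre _).trans (prop_contr L (hinst _ ht0) hherm htr hT0)
  have hval : 2 * c * N * (a ^ 2 - a * b + b ^ 2 / 2 + (b - a) / γ0 + 1 / γ0 ^ 2) =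
      c / γ0 ^ 2 * (3 / 2 + l + l ^ 2 / 2) * N := by
    rw [ha, hbdef]; field_simp; ring
  rw [hval] at key
  rw [hf0] at key
  linarith

theorem slow_aux {d m : ℕ}
    (L : Fin m → Matrix (Fin d) (Fin d) ℂ)
    (H H' : ℝ → Matrix (Fin d) (Fin d) ℂ)
    (hHherm : ∀ t, (H t).IsHermitian)
    (hHderiv : ∀ t i j, HasDerivAt (fun u => H u i j) (H' t i j) t)
    (K0 γ0 : ℝ) (hK0 : 0 < K0) (hγ0 : 0 < γ0)
    (hinst : ∀ t0, 0 ≤ t0 →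
      ExpContractiveWith (fun _ x => hamTerm (H t0) x + totalDissipator L x) K0 γ0)
    -- `sup_{t ≥ 0} ‖H'(t)‖_∞ < (2γ0²/3) / (1 + (2/3) ln K0 + (1/3) (ln K0)²)`,
    -- expressed via an upper bound `c`:
    (c : ℝ) (hbound : ∀ t, 0 ≤ t → opNorm (H' t) ≤ c)
    (hc : c < 2 * γ0 ^ 2 / 3 *
      (1 / (1 + 2 / 3 * Real.log K0 + 1 / 3 * Real.log K0 ^ 2))) :
    ExpContractive (driven H L) := by
  have hc0 : 0 ≤ c := (norm_nonneg _).trans (hbound 0 le_rfl)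
  -- reduction to differences
  have hdiff : ∀ s ρ σ, IsSolution (driven H L) s ρ → IsSolution (driven H L) s σ →
      ∀ t, s ≤ t → HasDerivAt (fun u => ρ u - σ u)
        (hamTerm (H t) (ρ t - σ t) + totalDissipator L (ρ t - σ t)) t := by
    intro s ρ σ hρ hσ t ht
    have h := (hasDerivAt_matrix (hρ t ht)).sub (hasDerivAt_matrix (hσ t ht))
    simp only [driven] at h
    rw [← lindCLM_apply, ← lindCLM_apply, ← map_sub] at h
    exact h
  by_cases hK1 : K0 < 1
  · refine ⟨1, 1, one_pos, one_pos, ?_⟩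
    intro s t hs hst ρ σ hρ hσ hρd hσd
    have hherm : (ρ s - σ s).IsHermitian := hρd.1.isHermitian.sub hσd.1.isHermitian
    have htr : (ρ s - σ s).trace = 0 := by rw [trace_sub, hρd.2, hσd.2, sub_self]
    have h1 := prop_contr L (hinst 0 le_rfl) hherm htr (le_refl 0)
    rw [prop_zero, mul_zero, Real.exp_zero, mul_one] at h1
    have h0 : traceNorm (ρ s - σ s) = 0 := by
      have := traceNorm_nonneg (ρ s - σ s)
      nlinarith
    have h2 := traceNorm_mono hHherm L (hdiff s ρ σ hρ hσ) hst
    simp only [h0] at h2 ⊢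
    simpa using h2
  have hK1 : 1 ≤ K0 := not_lt.1 hK1
  set l := Real.log K0 with hl
  have hl0 : 0 ≤ l := Real.log_nonneg hK1
  set q := c / γ0 ^ 2 * (3 / 2 + l + l ^ 2 / 2) with hq
  have hq0 : 0 ≤ q := by positivity
  have hq1 : q < 1 := by
    have hpos : 0 < 3 / 2 + l + l ^ 2 / 2 := by positivity
    have e : 2 * γ0 ^ 2 / 3 * (1 / (1 + 2 / 3 * l + 1 / 3 * l ^ 2)) =
        γ0 ^ 2 / (3 / 2 + l + l ^ 2 / 2) := by
      have : 1 + 2 / 3 * l + 1 / 3 * l ^ 2 ≠ 0 := by positivity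
      field_simp
    rw [e, lt_div_iff₀ hpos] at hc
    rw [hq, div_mul_eq_mul_div, div_lt_one (by positivity)]
    exact hc
  obtain ⟨T, hT0, hT1, hT2, hT3⟩ : ∃ T : ℝ, 0 < T ∧ (l + 1) / (2 * γ0) ≤ T ∧ l / γ0 ≤ T ∧
      K0 * Real.exp (-γ0 * T) < 1 - q := by
    have hlim : Filter.Tendsto (fun T : ℝ => K0 * Real.exp (-γ0 * T)) Filter.atTop (nhds 0) := by
      have h1 : Filter.Tendsto (fun T : ℝ => -γ0 * T) Filter.atTop Filter.atBot :=
        Filter.tendsto_id.const_mul_atTop_of_neg (by linarith)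
      simpa using (Real.tendsto_exp_atBot.comp h1).const_mul K0
    have h2 := hlim.eventually (gt_mem_nhds (by linarith : (0 : ℝ) < 1 - q))
    obtain ⟨T, h⟩ := (h2.and ((Filter.eventually_gt_atTop 0).and
      ((Filter.eventually_ge_atTop ((l + 1) / (2 * γ0))).and
        (Filter.eventually_ge_atTop (l / γ0))))).exists
    exact ⟨T, h.2.1, h.2.2.1, h.2.2.2, h.1⟩
  set r := q + K0 * Real.exp (-γ0 * T) with hr
  have hr0 : 0 < r := by positivity
  have hr1 : r < 1 := by linarith
  have hlr : Real.log r < 0 := Real.log_neg hr0 hr1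
  refine ⟨r⁻¹, -Real.log r / T, by positivity, div_pos (by linarith) hT0, ?_⟩
  intro s t hs hst ρ σ hρ hσ hρd hσd
  have hherm : (ρ s - σ s).IsHermitian := hρd.1.isHermitian.sub hσd.1.isHermitian
  have htr : (ρ s - σ s).trace = 0 := by rw [trace_sub, hρd.2, hσd.2, sub_self]
  set x : ℝ → Matrix (Fin d) (Fin d) ℂ := fun u => ρ u - σ u with hx
  have hsol := hdiff s ρ σ hρ hσ
  have hN0 := traceNorm_nonneg (x s)
  have hiter : ∀ k : ℕ, traceNorm (x (s + k * T)) ≤ r ^ k * traceNorm (x s) := by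
    intro k
    induction k with
    | zero => simp
    | succ k ih =>
      have hk : 0 ≤ (k : ℝ) * T := by positivity
      have hw := window L hHherm hHderiv hK1 hγ0 hinst hc0 hbound hT1 hT2
        (s := s + k * T) (by linarith) (x := x) (fun t ht => hsol t (by linarith))
        (sol_hermitian hHherm L hsol hherm (by linarith))
        ((sol_trace L hsol (by linarith)).trans htr)
      have e : s + ((k + 1 : ℕ) : ℝ) * T = s + k * T + T := by push_cast; ring
      rw [e]
      have h2 : r * traceNorm (x (s + k * T)) ≤ r * (r ^ k * traceNorm (x s)) :=
        mul_le_mul_of_nonneg_left ih hr0.le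
      rw [pow_succ' r k, mul_assoc]
      exact le_trans hw h2
  set k := ⌊(t - s) / T⌋₊ with hk
  have hk1 : (k : ℝ) ≤ (t - s) / T := Nat.floor_le (div_nonneg (by linarith) hT0.le)
  have hk2 : (t - s) / T < k + 1 := Nat.lt_floor_add_one _
  have hk3 : (k : ℝ) * T ≤ t - s := (le_div_iff₀ hT0).1 hk1
  have hk0 : 0 ≤ (k : ℝ) * T := by positivity
  have hmono := traceNorm_mono hHherm L (s := s + k * T) (x := x)
    (fun t ht => hsol t (by linarith)) (t := t) (by linarith)
  have hpow : r ^ k ≤ r⁻¹ * Real.exp (-(-Real.log r / T) * (t - s)) := by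
    have e1 : r⁻¹ * Real.exp (-(-Real.log r / T) * (t - s)) =
        Real.exp (Real.log r * ((t - s) / T - 1)) := by
      conv_lhs => rw [← Real.exp_log (inv_pos.2 hr0), Real.log_inv, ← Real.exp_add]
      congr 1
      field_simp
      ring
    have e2 : r ^ k = Real.exp (Real.log r * k) := by
      rw [mul_comm, Real.exp_nat_mul, Real.exp_log hr0]
    rw [e1, e2, Real.exp_le_exp]
    nlinarith
  calc traceNorm (ρ t - σ t) ≤ traceNorm (x (s + k * T)) := hmono
    _ ≤ r ^ k * traceNorm (x s) := hiter k
    _ ≤ _ := mul_le_mul_of_nonneg_right hpow hN0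

end helpers

/-- if the instantaneous Lindbladians are uniformly exponentially contractive
and the Hamiltonian varies slowly enough, then the driven Lindbladian is exponentially
contractive. -/
theorem slow_drive_contractive {d m : ℕ}
    (L : Fin m → Matrix (Fin d) (Fin d) ℂ)
    (H H' : ℝ → Matrix (Fin d) (Fin d) ℂ)
    (hHherm : ∀ t, (H t).IsHermitian)
    (hHderiv : ∀ t i j, HasDerivAt (fun u => H u i j) (H' t i j) t)
    (K0 γ0 : ℝ) (hK0 : 0 < K0) (hγ0 : 0 < γ0)
    (hinst : ∀ t0, 0 ≤ t0 →
      ExpContractiveWith (fun _ x => hamTerm (H t0) x + totalDissipator L x) K0 γ0)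
    -- `sup_{t ≥ 0} ‖H'(t)‖_∞ < (2γ0²/3) / (1 + (2/3) ln K0 + (1/3) (ln K0)²)`,
    -- expressed via an upper bound `c`:
    (c : ℝ) (hbound : ∀ t, 0 ≤ t → opNorm (H' t) ≤ c)
    (hc : c < 2 * γ0 ^ 2 / 3 *
      (1 / (1 + 2 / 3 * Real.log K0 + 1 / 3 * Real.log K0 ^ 2))) :
    ExpContractive (driven H L) := by
  exact slow_aux L H H' hHherm hHderiv K0 γ0 hK0 hγ0 hinst c hbound hc

end Paper
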